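/- In a single-source flow problem with arc capacities where the source must send 1 unit to sinks (open facilities), if node s can be feasibly served by configuration (W, X), then any node r with a directed open path from r to s can also be feasibly served by the same configuration. -/

import Mathlib

/-- Node s can be feasibly served by configuration (W, X): one unit of demand at s is
routed along open arcs to open facilities (uncapacitated: flow allowed exactly on open
arcs). -/
def Served {N : Type*} [Fintype N] (s : N) (W : N → ℝ) (X : N → N → Prop) : Prop :=
  ∃ Z : N → N → ℝ,
    (∀ i j, 0 ≤ Z i j) ∧
    (∀ i j, ¬ X i j → Z i j = 0) ∧
    (-(∑ j, Z s j) ≤ W s - 1) ∧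
    (∀ i, i ≠ s → (∑ j, Z j i) - (∑ j, Z i j) ≤ W i) ∧
    (∀ j, Z j s = 0)

/-- A served node reaches an open facility along open arcs. -/
theorem Served.exists_reachable_facility {N : Type*} [Fintype N] {W : N → ℝ}
    (hW : ∀ i, W i = 0 ∨ W i = 1) {X : N → N → Prop} {s : N} (hs : Served s W X) :
    ∃ t, Relation.ReflTransGen X s t ∧ W t = 1 := by
  classical
  obtain ⟨Z, hZ, hX, hout, hflow, hin⟩ := hs
  by_contra! hne
  have hW0 : ∀ i, Relation.ReflTransGen X s i → W i = 0 :=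
    fun i hi => (hW i).resolve_right (hne i hi)
  set R : Finset N := Finset.univ.filter (Relation.ReflTransGen X s) with hR
  have mem_R : ∀ i, i ∈ R ↔ Relation.ReflTransGen X s i := fun i => by simp [hR]
  have hsR : s ∈ R := (mem_R s).2 Relation.ReflTransGen.refl
  have out_eq : ∀ i ∈ R, ∑ j ∈ R, Z i j = ∑ j, Z i j := by
    intro i hi
    refine Finset.sum_subset (Finset.subset_univ R) fun j _ hj => hX i j fun hij => hj ?_
    exact (mem_R j).2 (((mem_R i).1 hi).tail hij)
  have le_in : ∀ i, ∑ j ∈ R, Z j i ≤ ∑ j, Z j i := fun i =>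
    Finset.sum_le_sum_of_subset_of_nonneg (Finset.subset_univ R) fun j _ _ => hZ j i
  have excess_le : ∀ i ∈ R, ∑ j ∈ R, Z j i - ∑ j ∈ R, Z i j ≤ if i = s then -1 else 0 := by
    intro i hi
    rw [out_eq i hi]
    have h0 := hW0 i ((mem_R i).1 hi)
    split_ifs with his
    · subst his
      have : ∑ j ∈ R, Z j i = 0 := Finset.sum_eq_zero fun j _ => hin j
      linarith
    · linarith [hflow i his, le_in i]
  have hsum := Finset.sum_le_sum excess_le
  rw [Finset.sum_sub_distrib, Finset.sum_comm, sub_self, Finset.sum_ite_eq' R s, if_pos hsR] at hsum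
  linarith

/-- A node `r` from which an open facility can be reached lies in a finite set of nodes, each of
which is served by a flow that stays inside the set. -/
theorem exists_finset_forall_served_within {N : Type*} [Fintype N] {W : N → ℝ}
    (hW : ∀ i, 0 ≤ W i) {X : N → N → Prop} {r t : N} (hrt : Relation.ReflTransGen X r t)
    (ht : 1 ≤ W t) :
    ∃ S : Finset N, r ∈ S ∧ ∀ v ∈ S, Served v W (fun i j => X i j ∧ i ∈ S ∧ j ∈ S) := by
  classical
  induction hrt using Relation.ReflTransGen.head_induction_on with
  | refl =>
    refine ⟨{t}, Finset.mem_singleton_self t, fun v hv => ?_⟩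
    obtain rfl := Finset.mem_singleton.1 hv
    exact ⟨fun _ _ => 0, by simp, by simp, by simpa using ht, fun i _ => by simpa using hW i,
      by simp⟩
  | @head r c hrc _ ih =>
    obtain ⟨S, hcS, hS⟩ := ih
    by_cases hrS : r ∈ S
    · exact ⟨S, hrS, hS⟩
    refine ⟨insert r S, Finset.mem_insert_self r S, fun v hv => ?_⟩
    rcases Finset.mem_insert.1 hv with rfl | hvS
    · obtain ⟨Z, hZ, hX, hout, hflow, hin⟩ := hS c hcS
      have hcv : c ≠ v := fun h => hrS (h ▸ hcS)
      have row : ∀ j, Z v j = 0 := fun j => hX v j fun h => hrS h.2.1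
      have col : ∀ j, Z j v = 0 := fun j => hX j v fun h => hrS h.2.2
      refine ⟨fun i j => Z i j + if i = v then (if j = c then 1 else 0) else 0,
        fun i j => ?_, fun i j hij => ?_, ?_, fun i hi => ?_, fun j => ?_⟩
      · have := hZ i j
        dsimp only
        split_ifs <;> linarith
      · have hz : Z i j = 0 := hX i j fun h =>
          hij ⟨h.1, Finset.mem_insert_of_mem h.2.1, Finset.mem_insert_of_mem h.2.2⟩
        have hne : ¬ (i = v ∧ j = c) := by
          rintro ⟨rfl, rfl⟩
          exact hij ⟨hrc, Finset.mem_insert_self _ _, Finset.mem_insert_of_mem hcS⟩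
        dsimp only
        rw [hz, zero_add, ← ite_and, if_neg hne]
      · simpa [row] using hW v
      · by_cases hic : i = c
        · subst hic
          simp only [Finset.sum_add_distrib, hin, hi]
          simp
          linarith
        · simpa [Finset.sum_add_distrib, hi, hic] using hflow i hic
      · simp [col, hcv.symm]
    · obtain ⟨Z, hZ, hX, hrest⟩ := hS v hvS
      exact ⟨Z, hZ, fun i j hij => hX i j fun h =>
        hij ⟨h.1, Finset.mem_insert_of_mem h.2.1, Finset.mem_insert_of_mem h.2.2⟩, hrest⟩

/-- if node s can be feasibly served and there is a directed path of
open arcs from r to s, then r can also be feasibly served by the same configuration. -/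
theorem stmt17 {N : Type*} [Fintype N] [DecidableEq N]
    (W : N → ℝ) (hW : ∀ i, W i = 0 ∨ W i = 1) (X : N → N → Prop)
    (s r : N) (hpath : Relation.ReflTransGen X r s)
    (hs : Served s W X) : Served r W X := by
  obtain ⟨t, hst, ht⟩ := hs.exists_reachable_facility hW
  have hW0 : ∀ i, 0 ≤ W i := fun i => by rcases hW i with h | h <;> simp [h]
  obtain ⟨S, hrS, hS⟩ := exists_finset_forall_served_within hW0 (hpath.trans hst) ht.ge
  obtain ⟨Z, hZ, hX, hrest⟩ := hS r hrS
  exact ⟨Z, hZ, fun i j hij => hX i j fun h => hij h.1, hrest⟩
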